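/- Let R be an associative ring with identity and let a, b be elements of the center C(R) of R. Then R is strongly (x−a)(x−b)-clean (i.e., every r ∈ R can be written as r = s + u where (s−a)(s−b) = 0, u is a unit of R, and su = us) if and only if R is strongly clean and b − a is a unit of R. -/

import Mathlib

/-- A ring is *strongly clean* if every element is the sum of an idempotent
and a unit that commute. -/
def StronglyClean (R : Type*) [Ring R] : Prop :=
  ∀ r : R, ∃ e u : R, e * e = e ∧ IsUnit u ∧ r = e + u ∧ e * u = u * e

/-- For `a, b` in the center of `R`, `R` is strongly `(x−a)(x−b)`-clean iff
`R` is strongly clean and `b − a` is a unit. -/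
theorem strongly_sub_a_sub_b_clean_iff (R : Type*) [Ring R] (a b : R)
    (ha : a ∈ Set.center R) (hb : b ∈ Set.center R) :
    (∀ r : R, ∃ s u : R, (s - a) * (s - b) = 0 ∧ IsUnit u ∧ r = s + u ∧ s * u = u * s) ↔
      (StronglyClean R ∧ IsUnit (b - a)) := by
  have hc : ∀ x, Commute (b - a) x := fun x =>
    Commute.sub_left (Set.mem_center_iff.1 hb |>.comm x) (Set.mem_center_iff.1 ha |>.comm x)
  have ha' : ∀ x, Commute a x := fun x => Set.mem_center_iff.1 ha |>.comm x
  constructor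
  · intro h
    have hu : IsUnit (b - a) := by
      obtain ⟨s, u, hs, hu, hr, -⟩ := h a
      have hsa : s - a = -u := by rw [hr]; abel
      rw [hsa] at hs
      have hsb : s = b := sub_eq_zero.1 (hu.neg.mul_right_eq_zero.1 hs)
      rw [← hsb, hsa]
      exact hu.neg
    refine ⟨fun r => ?_, hu⟩
    obtain ⟨c, hcu⟩ := hu
    rw [← hcu] at hc
    have hd : ∀ x, Commute (↑c⁻¹ : R) x := fun x => (hc x).units_inv_left
    obtain ⟨s, u, hs, hu, hr, hsu⟩ := h (a + c * r)
    refine ⟨↑c⁻¹ * (s - a), ↑c⁻¹ * u, ?_, c⁻¹.isUnit.mul hu, ?_, ?_⟩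
    · have hsq : (s - a) * (s - a) = c * (s - a) := by
        rw [(hc (s - a)).eq, hcu, ← sub_eq_zero, ← mul_sub]
        simpa using hs
      rw [(hd (s - a)).symm.mul_mul_mul_comm, hsq, mul_assoc, c.inv_mul_cancel_left]
    · rw [← mul_add, show s - a + u = c * r by rw [sub_add_eq_add_sub, ← hr]; abel,
        c.inv_mul_cancel_left]
    · have hsau : Commute (s - a) u := Commute.sub_left hsu (ha' u)
      exact (hd _).mul_left (((hd _).symm).mul_right hsau)
  · rintro ⟨h, c, hcu⟩ r
    rw [← hcu] at hc
    obtain ⟨e, u, he, hu, hr, heu⟩ := h (↑c⁻¹ * (r - a))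
    refine ⟨a + c * e, c * u, ?_, c.isUnit.mul hu, ?_, ?_⟩
    · have hsb : a + c * e - b = c * (e - 1) := by rw [mul_sub, mul_one, hcu]; abel
      rw [hsb, add_sub_cancel_left, (hc e).symm.mul_mul_mul_comm, mul_sub, he, mul_one, sub_self,
        mul_zero]
    · rw [add_assoc, ← mul_add, ← hr, c.mul_inv_cancel_left, add_sub_cancel]
    · exact (ha' _).add_left ((hc _).mul_left (((hc _).symm).mul_right heu))
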